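/- Let β > 1, m the largest integer strictly less than β, and α = β - m ∈ (0,1]. A continuous bounded 1-periodic f : ℝ^d → ℝ belongs to B^β_{∞,∞} in the approximation sense if and only if f is of class C^m and every partial derivative of f of order m belongs to B^α_{∞,∞} in the approximation sense. -/

import Mathlib

open MeasureTheory Real ENNReal

noncomputable section

/-- The rescaled kernel `K_h(t) = h^{-d} K(t/h)`. -/
def resKer (d : ℕ) (K : EuclideanSpace ℝ (Fin d) → ℝ) (h : ℝ) :
    EuclideanSpace ℝ (Fin d) → ℝ :=
  fun t => (h ^ d)⁻¹ * K (h⁻¹ • t)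

/-- Convolution `(g * f)(t) = ∫ g(t-u) f(u) du` on `ℝ^d`. -/
def convol (d : ℕ) (g f : EuclideanSpace ℝ (Fin d) → ℝ) :
    EuclideanSpace ℝ (Fin d) → ℝ :=
  fun t => ∫ u, g (t - u) * f u

/-- The sup-norm `‖f‖_∞` (essential supremum of `|f|` over `ℝ^d`), with values in `ℝ≥0∞`. -/
def supNorm (d : ℕ) (f : EuclideanSpace ℝ (Fin d) → ℝ) : ℝ≥0∞ :=
  eLpNorm f ⊤ volume

/-- `f` is 1-periodic: `f(x + e_i) = f(x)` for every standard basis vector `e_i`. -/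
def Per1 (d : ℕ) (f : EuclideanSpace ℝ (Fin d) → ℝ) : Prop :=
  ∀ x (i : Fin d), f (x + EuclideanSpace.single i 1) = f x

/-- `f` is bounded and measurable. -/
def BddMeas (d : ℕ) (f : EuclideanSpace ℝ (Fin d) → ℝ) : Prop :=
  Measurable f ∧ ∃ M, ∀ x, |f x| ≤ M

/-- The partial derivative `∂f/∂t_i`. -/
def pderiv1 (d : ℕ) (i : Fin d) (f : EuclideanSpace ℝ (Fin d) → ℝ) :
    EuclideanSpace ℝ (Fin d) → ℝ :=
  fun x => fderiv ℝ f x (EuclideanSpace.single i 1)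

/-- The partial derivative `∂^α f = ∂^{α_1}_{t_1} ⋯ ∂^{α_d}_{t_d} f` for a multi-index `α`. -/
def pderivM (d : ℕ) (α : Fin d → ℕ) (f : EuclideanSpace ℝ (Fin d) → ℝ) :
    EuclideanSpace ℝ (Fin d) → ℝ :=
  (List.finRange d).foldr (fun i g => (pderiv1 d i)^[α i] g) f

/-- The kernel class `K(N)`: conditions (A1)–(A6) of the paper. -/
def KernelClass (d N : ℕ) (K : EuclideanSpace ℝ (Fin d) → ℝ) : Prop :=
  -- (A1) compact support
  HasCompactSupport K ∧
  -- (A2) square-integrable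
  Integrable (fun u => K u ^ 2) ∧
  -- (A3) L² increment bound
  (∃ C > 0, ∃ γ ∈ Set.Ioc (0 : ℝ) 1, ∀ t : EuclideanSpace ℝ (Fin d), ‖t‖ ≤ 1 →
    ∫ u, (K (t + u) - K u) ^ 2 ≤ C * ‖t‖ ^ (2 * γ)) ∧
  -- (A4) unit mass
  (∫ u, K u) = 1 ∧
  -- (A5) smoothness and integrable partial derivatives up to order N
  (ContDiff ℝ N K ∧ ∀ α : Fin d → ℕ, (∑ i, α i) ≤ N →
    Integrable (fun t => |pderivM d α K t|)) ∧
  -- (A6) vanishing moments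
  (∀ α : Fin d → ℕ, 1 ≤ (∑ i, α i) → (∑ i, α i) ≤ N →
    ∫ u, (∏ i, u i ^ α i) * K u = 0)

/-- The bandwidth class `H`: `h_n = 2^{-m_n}` with `(m_n)` nondecreasing positive integers
tending to `∞` and with bounded increments. -/
def BandClass (h : ℕ → ℝ) : Prop :=
  ∃ m : ℕ → ℕ, (∀ n, 0 < m n) ∧ Monotone m ∧
    Filter.Tendsto m Filter.atTop Filter.atTop ∧
    (∃ B : ℕ, ∀ n, m (n + 1) - m n ≤ B) ∧
    ∀ n, h n = (2 : ℝ) ^ (-(m n : ℝ))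

/-- `f` belongs to the Besov space `B^β_{∞,∞}` in the approximation sense: there are bounded
1-periodic `C^N` functions `f_j` with `sup_j 2^{jβ} ‖f - f_j‖_∞ < ∞` and
`sup_j 2^{-(N-β)j} ‖∂^α f_j‖_∞ < ∞` for every multi-index `α` with `|α| = N`. -/
def MemBesov (d : ℕ) (β : ℝ) (N : ℕ) (f : EuclideanSpace ℝ (Fin d) → ℝ) : Prop :=
  ∃ fs : ℕ → EuclideanSpace ℝ (Fin d) → ℝ,
    (∀ j, 1 ≤ j → (∃ M, ∀ x, |fs j x| ≤ M) ∧ Per1 d (fs j) ∧ ContDiff ℝ N (fs j)) ∧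
    (∃ C : ℝ, ∀ j : ℕ, 1 ≤ j →
      supNorm d (fun x => f x - fs j x) ≤ ENNReal.ofReal (C * 2 ^ (-(j : ℝ) * β))) ∧
    (∃ C : ℝ, ∀ α : Fin d → ℕ, (∑ i, α i) = N → ∀ j : ℕ, 1 ≤ j →
      supNorm d (pderivM d α (fs j)) ≤ ENNReal.ofReal (C * 2 ^ (((N : ℝ) - β) * j)))

/-- The Hölder class `Σ(β)`: `f` is a bounded 1-periodic function of class `C^m`
(`m` the largest integer strictly less than `β`) all of whose partial derivatives of order `m`
are `(β-m)`-Hölder. -/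
def HolderSigma (d : ℕ) (β : ℝ) (f : EuclideanSpace ℝ (Fin d) → ℝ) : Prop :=
  ∃ m : ℕ, (m : ℝ) < β ∧ β ≤ (m : ℝ) + 1 ∧
    ContDiff ℝ m f ∧ (∃ M, ∀ x, |f x| ≤ M) ∧ Per1 d f ∧
    ∀ σ : Fin d → ℕ, (∑ i, σ i) = m → ∃ C : ℝ, ∀ x y,
      |pderivM d σ f x - pderivM d σ f y| ≤ C * ‖x - y‖ ^ (β - (m : ℝ))

end

section IteratedPartialDerivatives

variable {d : ℕ}

/-- The iterated partial derivative `∂_{i₁} ⋯ ∂_{iₖ} g` along the list `[i₁, …, iₖ]`. -/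
noncomputable def dlist (L : List (Fin d)) (g : EuclideanSpace ℝ (Fin d) → ℝ) : EuclideanSpace ℝ (Fin d) → ℝ :=
  L.foldr (pderiv1 d) g

@[simp] lemma dlist_nil (g : EuclideanSpace ℝ (Fin d) → ℝ) : dlist [] g = g := rfl

@[simp] lemma dlist_cons (i : Fin d) (L : List (Fin d)) (g : EuclideanSpace ℝ (Fin d) → ℝ) :
    dlist (i :: L) g = pderiv1 d i (dlist L g) := rfl

lemma dlist_append (L L' : List (Fin d)) (g : EuclideanSpace ℝ (Fin d) → ℝ) :
    dlist (L ++ L') g = dlist L (dlist L' g) := by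
  simp [dlist, List.foldr_append]

lemma contDiff_pderiv1 {n : ℕ} {g : EuclideanSpace ℝ (Fin d) → ℝ}
    (hg : ContDiff ℝ (n + 1 : ℕ) g) (i : Fin d) : ContDiff ℝ n (pderiv1 d i g) :=
  (hg.fderiv_right (m := n) (by norm_cast)).clm_apply contDiff_const

lemma contDiff_dlist {n : ℕ} (L : List (Fin d)) {g : EuclideanSpace ℝ (Fin d) → ℝ}
    (hg : ContDiff ℝ (n + L.length : ℕ) g) : ContDiff ℝ n (dlist L g) := by
  induction L generalizing n with
  | nil => simpa using hg
  | cons i L ih =>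
    exact contDiff_pderiv1 (ih (n := n + 1) (hg.of_le (by simp only [List.length_cons]; norm_cast; lia))) i

lemma contDiff_dlist_of_le {n k : ℕ} {L : List (Fin d)} {g : EuclideanSpace ℝ (Fin d) → ℝ}
    (hg : ContDiff ℝ k g) (h : n + L.length ≤ k) : ContDiff ℝ n (dlist L g) :=
  contDiff_dlist L (hg.of_le (by exact_mod_cast h))

lemma continuous_dlist {k : ℕ} {L : List (Fin d)} {g : EuclideanSpace ℝ (Fin d) → ℝ}
    (hg : ContDiff ℝ k g) (h : L.length ≤ k) : Continuous (dlist L g) :=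
  (contDiff_dlist_of_le (n := 0) hg (by simpa using h)).continuous

lemma Per1.pderiv1 {g : EuclideanSpace ℝ (Fin d) → ℝ} (hg : Per1 d g) (i : Fin d) :
    Per1 d (pderiv1 d i g) := by
  intro x j
  have h : (fun y => g (y + EuclideanSpace.single j 1)) = g := funext fun y => hg y j
  have := fderiv_comp_add_right (𝕜 := ℝ) (f := g) (x := x) (EuclideanSpace.single j 1)
  rw [h] at this
  simp [_root_.pderiv1, this]

lemma Per1.dlist {g : EuclideanSpace ℝ (Fin d) → ℝ} (hg : Per1 d g) (L : List (Fin d)) :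
    Per1 d (dlist L g) := by
  induction L with
  | nil => exact hg
  | cons i L ih => exact ih.pderiv1 i

lemma dlist_sub {L : List (Fin d)} {g₁ g₂ : EuclideanSpace ℝ (Fin d) → ℝ}
    (h₁ : ContDiff ℝ L.length g₁) (h₂ : ContDiff ℝ L.length g₂) :
    dlist L (g₁ - g₂) = dlist L g₁ - dlist L g₂ := by
  induction L with
  | nil => rfl
  | cons i L ih =>
    have k₁ : ContDiff ℝ (1 : ℕ) (dlist L g₁) := contDiff_dlist_of_le h₁ (by simp [add_comm])
    have k₂ : ContDiff ℝ (1 : ℕ) (dlist L g₂) := contDiff_dlist_of_le h₂ (by simp [add_comm])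
    rw [dlist_cons, ih (h₁.of_le (by simp)) (h₂.of_le (by simp))]
    funext x
    simp only [pderiv1, dlist_cons, Pi.sub_apply]
    rw [fderiv_sub (k₁.differentiable (by simp) x) (k₂.differentiable (by simp) x)]
    rfl

lemma dlist_add {L : List (Fin d)} {g₁ g₂ : EuclideanSpace ℝ (Fin d) → ℝ}
    (h₁ : ContDiff ℝ L.length g₁) (h₂ : ContDiff ℝ L.length g₂) :
    dlist L (g₁ + g₂) = dlist L g₁ + dlist L g₂ := by
  have := dlist_sub (g₁ := g₁ + g₂) (h₁.add h₂) h₂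
  rw [add_sub_cancel_right] at this
  rw [this, sub_add_cancel]

lemma dlist_comp_smul (L : List (Fin d)) (c : ℝ) (g : EuclideanSpace ℝ (Fin d) → ℝ) :
    dlist L (fun x => g (c • x)) = fun x => c ^ L.length * dlist L g (c • x) := by
  induction L with
  | nil => simp
  | cons i L ih =>
    funext x
    simp only [dlist_cons, ih, pderiv1]
    rw [show (fun x => c ^ L.length * dlist L g (c • x))
      = c ^ L.length • fun x => dlist L g (c • x) from rfl, fderiv_const_smul_field,
      Pi.smul_apply, fderiv_comp_smul]
    simp [pow_succ, mul_assoc]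

lemma pderiv1_comm {g : EuclideanSpace ℝ (Fin d) → ℝ} (hg : ContDiff ℝ 2 g) (i j : Fin d) :
    pderiv1 d i (pderiv1 d j g) = pderiv1 d j (pderiv1 d i g) := by
  have hd : Differentiable ℝ (fderiv ℝ g) :=
    (hg.fderiv_right (m := 1) (by norm_num)).differentiable (by simp)
  have key : ∀ (i j : Fin d) x, pderiv1 d i (pderiv1 d j g) x
      = fderiv ℝ (fderiv ℝ g) x (EuclideanSpace.single i 1) (EuclideanSpace.single j 1) := by
    intro i j x
    unfold pderiv1
    rw [fderiv_clm_apply (hd x) (differentiableAt_const _)]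
    simp
  funext x
  rw [key, key]
  exact hg.contDiffAt.isSymmSndFDerivAt (by simp) _ _

lemma dlist_perm {L L' : List (Fin d)} (h : L.Perm L') {g : EuclideanSpace ℝ (Fin d) → ℝ}
    (hg : ContDiff ℝ L.length g) : dlist L g = dlist L' g := by
  induction h with
  | nil => rfl
  | cons i _ ih => rw [dlist_cons, dlist_cons, ih (hg.of_le (by simp))]
  | swap i j L =>
    exact pderiv1_comm (contDiff_dlist_of_le (n := 2) hg (by simp; lia)) _ _
  | trans h₁ _ ih₁ ih₂ => rw [ih₁ hg, ih₂ (by rwa [← h₁.length_eq])]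

/-- The nondecreasing list in which each index `i` occurs `σ i` times. -/
def multiList (σ : Fin d → ℕ) : List (Fin d) :=
  (List.finRange d).flatMap fun i => List.replicate (σ i) i

lemma pderivM_eq_dlist (σ : Fin d → ℕ) (g : EuclideanSpace ℝ (Fin d) → ℝ) :
    pderivM d σ g = dlist (multiList σ) g := by
  have hrep : ∀ (n : ℕ) (i : Fin d) g, dlist (List.replicate n i) g = (pderiv1 d i)^[n] g := by
    intro n i g
    induction n with
    | zero => rfl
    | succ n ih => rw [List.replicate_succ, dlist_cons, ih, Function.iterate_succ_apply']
  unfold pderivM multiList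
  induction List.finRange d with
  | nil => rfl
  | cons i l ih => rw [List.foldr_cons, ih, List.flatMap_cons, dlist_append, hrep]

lemma length_multiList (σ : Fin d → ℕ) : (multiList σ).length = ∑ i, σ i := by
  simp [multiList, List.length_flatMap, Fin.sum_univ_def]

lemma count_multiList (σ : Fin d → ℕ) (i : Fin d) : (multiList σ).count i = σ i := by
  rw [multiList, List.count_flatMap]
  have : (List.count i ∘ fun j => List.replicate (σ j) j) = fun j => if j = i then σ j else 0 := by
    funext j
    simp [List.count_replicate]
  rw [this, ← Fin.sum_univ_def]
  simp

lemma perm_multiList_count (L : List (Fin d)) : L.Perm (multiList fun i => L.count i) :=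
  List.perm_iff_count.2 fun i => (count_multiList (fun i => L.count i) i).symm

lemma dlist_eq_pderivM (L : List (Fin d)) {g : EuclideanSpace ℝ (Fin d) → ℝ}
    (hg : ContDiff ℝ L.length g) : dlist L g = pderivM d (fun i => L.count i) g := by
  rw [pderivM_eq_dlist]
  exact dlist_perm (perm_multiList_count L) hg

lemma sum_count_eq_length (L : List (Fin d)) : ∑ i, L.count i = L.length := by
  rw [← length_multiList]
  exact (perm_multiList_count L).length_eq.symm

lemma euclidean_eq_sum_single (x : EuclideanSpace ℝ (Fin d)) :
    x = ∑ i, x i • EuclideanSpace.single i (1 : ℝ) := by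
  ext j
  simp [Pi.single_apply]

lemma fderiv_eq_sum_pderiv1 (g : EuclideanSpace ℝ (Fin d) → ℝ) (x : EuclideanSpace ℝ (Fin d)) :
    fderiv ℝ g x = ∑ i, pderiv1 d i g x •
    (EuclideanSpace.proj i : EuclideanSpace ℝ (Fin d) →L[ℝ] ℝ) := by
  ext v
  conv_lhs => rw [euclidean_eq_sum_single v, map_sum]
  simp [pderiv1, mul_comm]

lemma norm_proj_le_one (i : Fin d) :
    ‖(EuclideanSpace.proj i : EuclideanSpace ℝ (Fin d) →L[ℝ] ℝ)‖ ≤ 1 :=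
  ContinuousLinearMap.opNorm_le_bound _ zero_le_one fun x => by
    simpa using PiLp.norm_apply_le x i

lemma norm_sum_smul_proj_le {c : Fin d → ℝ} {B : ℝ} (h : ∀ i, |c i| ≤ B) :
    ‖∑ i, c i • (EuclideanSpace.proj i :
      EuclideanSpace ℝ (Fin d) →L[ℝ] ℝ)‖ ≤ d * B := by
  calc _ ≤ ∑ _i : Fin d, B := norm_sum_le_of_le _ fun i _ => by
        rw [norm_smul]
        exact (mul_le_of_le_one_right (norm_nonneg _) (norm_proj_le_one i)).trans (h i)
    _ = d * B := by simp

lemma norm_fderiv_le {g : EuclideanSpace ℝ (Fin d) → ℝ} {B : ℝ} {x : EuclideanSpace ℝ (Fin d)}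
    (h : ∀ i, |pderiv1 d i g x| ≤ B) : ‖fderiv ℝ g x‖ ≤ d * B := by
  rw [fderiv_eq_sum_pderiv1]
  exact norm_sum_smul_proj_le h

lemma Per1.exists_bound {g : EuclideanSpace ℝ (Fin d) → ℝ} (hg : Per1 d g) (hc : Continuous g) :
    ∃ M, ∀ x, |g x| ≤ M := by
  have hz : ∀ (s : Finset (Fin d)) (n : Fin d → ℤ),
      Function.Periodic g (∑ i ∈ s, n i • EuclideanSpace.single i (1 : ℝ)) := by
    intro s n
    induction s using Finset.induction_on with
    | empty => intro x; simp
    | insert i s hi ih =>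
      rw [Finset.sum_insert hi]
      exact Function.Periodic.add_period (Function.Periodic.zsmul (fun x => hg x i) _) ih
  obtain ⟨M, hM⟩ := (isCompact_closedBall (0 : EuclideanSpace ℝ (Fin d)) d).exists_bound_of_continuousOn
    hc.continuousOn
  refine ⟨M, fun x => ?_⟩
  rw [← hz Finset.univ (fun i => -⌊x i⌋) x]
  refine hM _ ?_
  rw [mem_closedBall_zero_iff]
  conv_lhs => enter [1, 1]; rw [euclidean_eq_sum_single x]
  rw [← Finset.sum_add_distrib]
  calc _ ≤ ∑ _i : Fin d, (1 : ℝ) := norm_sum_le_of_le _ fun i _ => by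
        rw [← Int.cast_smul_eq_zsmul ℝ, ← add_smul, norm_smul, PiLp.norm_single]
        push_cast
        rw [← sub_eq_add_neg, Int.self_sub_floor, norm_one, mul_one, Real.norm_eq_abs,
          Int.abs_fract]
        exact (Int.fract_lt_one _).le
    _ = d := by simp

end IteratedPartialDerivatives

section Mollification

open scoped Convolution

variable {d : ℕ}

/-- A smooth nonnegative function of unit mass supported in the closed unit ball. -/
noncomputable def unitBump (d : ℕ) : EuclideanSpace ℝ (Fin d) → ℝ :=
  (⟨1 / 2, 1, by norm_num, by norm_num⟩ :
    ContDiffBump (0 : EuclideanSpace ℝ (Fin d))).normed volume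

lemma unitBump_nonneg (u : EuclideanSpace ℝ (Fin d)) : 0 ≤ unitBump d u :=
  ContDiffBump.nonneg_normed _ u

lemma integral_unitBump : ∫ u, unitBump d u = 1 := ContDiffBump.integral_normed _

lemma contDiff_unitBump {n : ℕ∞} : ContDiff ℝ n (unitBump d) := ContDiffBump.contDiff_normed _

lemma hasCompactSupport_unitBump : HasCompactSupport (unitBump d) :=
  ContDiffBump.hasCompactSupport_normed _

lemma continuous_unitBump : Continuous (unitBump d) := ContDiffBump.continuous_normed _

lemma integrable_unitBump : Integrable (unitBump d) := ContDiffBump.integrable_normed _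

lemma unitBump_eq_zero {u : EuclideanSpace ℝ (Fin d)} (hu : 1 < ‖u‖) : unitBump d u = 0 := by
  by_contra h
  have : u ∈ Function.support (unitBump d) := h
  rw [unitBump, ContDiffBump.support_normed_eq, mem_ball_zero_iff] at this
  exact absurd this (not_lt.2 hu.le)

/-- The mollification of `g` at scale `h`. -/
noncomputable def mollify (h : ℝ) (g : EuclideanSpace ℝ (Fin d) → ℝ) :
    EuclideanSpace ℝ (Fin d) → ℝ :=
  fun x => ∫ u, unitBump d u * g (x - h • u)

lemma integrable_unitBump_mul {g : EuclideanSpace ℝ (Fin d) → ℝ} (hg : Continuous g) :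
    Integrable fun u => unitBump d u * g u :=
  (continuous_unitBump.mul hg).integrable_of_hasCompactSupport hasCompactSupport_unitBump.mul_right

lemma abs_integral_unitBump_mul_le {g : EuclideanSpace ℝ (Fin d) → ℝ} {A : ℝ}
    (h : ∀ u, ‖u‖ ≤ 1 → |g u| ≤ A) : |∫ u, unitBump d u * g u| ≤ A := by
  calc |∫ u, unitBump d u * g u| ≤ ∫ u, unitBump d u * A := by
        rw [← Real.norm_eq_abs]
        refine norm_integral_le_of_norm_le (integrable_unitBump.mul_const A) (ae_of_all _ fun u => ?_)
        rcases le_or_gt ‖u‖ 1 with hu | hu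
        · rw [norm_mul, Real.norm_of_nonneg (unitBump_nonneg u)]
          exact mul_le_mul_of_nonneg_left (h u hu) (unitBump_nonneg u)
        · simp [unitBump_eq_zero hu]
    _ = A := by rw [integral_mul_const, integral_unitBump, one_mul]

lemma abs_mollify_le {g : EuclideanSpace ℝ (Fin d) → ℝ} {A : ℝ} (hA : ∀ x, |g x| ≤ A) (h : ℝ)
    (x : EuclideanSpace ℝ (Fin d)) : |mollify h g x| ≤ A :=
  abs_integral_unitBump_mul_le fun _ _ => hA _

lemma abs_sub_mollify_le {g : EuclideanSpace ℝ (Fin d) → ℝ} (hg : ContDiff ℝ 1 g) {B h : ℝ}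
    (hh : 0 ≤ h) (hB : ∀ i x, |pderiv1 d i g x| ≤ B) (x : EuclideanSpace ℝ (Fin d)) :
    |g x - mollify h g x| ≤ d * h * B := by
  have hc := hg.continuous
  have : g x - mollify h g x = ∫ u, unitBump d u * (g x - g (x - h • u)) := by
    simp only [mul_sub]
    rw [integral_sub (integrable_unitBump.mul_const _) (integrable_unitBump_mul (by fun_prop)),
      integral_mul_const, integral_unitBump, one_mul]
    rfl
  rw [this]
  refine abs_integral_unitBump_mul_le fun u hu => ?_
  have hlip := Convex.norm_image_sub_le_of_norm_fderiv_le (𝕜 := ℝ) (f := g) (s := Set.univ)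
    (C := d * B) (fun y _ => hg.differentiable (by simp) y)
    (fun y _ => norm_fderiv_le fun i => hB i y) convex_univ (Set.mem_univ (x - h • u))
    (Set.mem_univ x)
  rw [_root_.sub_sub_cancel, norm_smul, Real.norm_of_nonneg hh] at hlip
  have hdB : 0 ≤ d * B := (norm_nonneg _).trans (norm_fderiv_le fun i => hB i x)
  calc |g x - g (x - h • u)| ≤ d * B * (h * ‖u‖) := hlip
    _ ≤ d * B * (h * 1) := by gcongr
    _ = d * h * B := by ring

lemma mollify_sub {g₁ g₂ : EuclideanSpace ℝ (Fin d) → ℝ} (h₁ : Continuous g₁) (h₂ : Continuous g₂)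
    (h : ℝ) : mollify h (g₁ - g₂) = mollify h g₁ - mollify h g₂ := by
  funext x
  simp only [mollify, Pi.sub_apply, mul_sub]
  exact integral_sub (integrable_unitBump_mul (by fun_prop)) (integrable_unitBump_mul (by fun_prop))

lemma Per1.mollify {g : EuclideanSpace ℝ (Fin d) → ℝ} (hg : Per1 d g) (h : ℝ) :
    Per1 d (mollify h g) := by
  intro x i
  simp only [_root_.mollify]
  congr 1
  funext u
  rw [add_sub_right_comm, hg]

lemma mollify_eq_convolution (h : ℝ) (hh : h ≠ 0) (g : EuclideanSpace ℝ (Fin d) → ℝ) :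
    mollify h g = fun x =>
      ((fun y => g (h • y)) ⋆[ContinuousLinearMap.mul ℝ ℝ, volume] unitBump d) (h⁻¹ • x) := by
  funext x
  rw [convolution_mul_swap]
  simp [mollify, smul_sub, smul_smul, hh, mul_comm]

lemma contDiff_mollify {g : EuclideanSpace ℝ (Fin d) → ℝ} (hg : Continuous g) {h : ℝ} (hh : h ≠ 0)
    (n : ℕ) : ContDiff ℝ n (mollify h g) := by
  rw [mollify_eq_convolution h hh]
  exact (hasCompactSupport_unitBump.contDiff_convolution_right (n := n) _
    (Continuous.locallyIntegrable (by fun_prop)) contDiff_unitBump).comp (contDiff_const_smul _)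

lemma dlist_convolution {g κ : EuclideanSpace ℝ (Fin d) → ℝ} (hg : Continuous g)
    (hκ : ∀ n : ℕ, ContDiff ℝ n κ) (hs : HasCompactSupport κ) (L : List (Fin d)) :
    dlist L (g ⋆[ContinuousLinearMap.mul ℝ ℝ, volume] κ) =
        g ⋆[ContinuousLinearMap.mul ℝ ℝ, volume] (dlist L κ) ∧
      HasCompactSupport (dlist L κ) := by
  induction L with
  | nil => exact ⟨rfl, hs⟩
  | cons i L ih =>
    obtain ⟨ih, hs'⟩ := ih
    have hκ' : ContDiff ℝ 1 (dlist L κ) := contDiff_dlist_of_le (n := 1) (hκ (1 + L.length)) le_rfl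
    refine ⟨?_, hs'.fderiv_apply ℝ _⟩
    rw [dlist_cons, ih]
    funext x
    rw [pderiv1, (hs'.hasFDerivAt_convolution_right _ hg.locallyIntegrable hκ' x).fderiv,
      convolution_precompR_apply _ hg.locallyIntegrable (hs'.fderiv ℝ)
        (hκ'.continuous_fderiv (by simp))]
    rfl

lemma exists_abs_dlist_mollify_le (L : List (Fin d)) :
    ∃ C, 0 ≤ C ∧ ∀ (g : EuclideanSpace ℝ (Fin d) → ℝ) (h A : ℝ), Continuous g → 0 < h →
      (∀ x, |g x| ≤ A) → ∀ x, |dlist L (mollify h g) x| ≤ C * h⁻¹ ^ L.length * A := by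
  refine ⟨∫ u, |dlist L (unitBump d) u|, integral_nonneg fun _ => abs_nonneg _, ?_⟩
  intro g h A hg hh hA x
  obtain ⟨hconv, hs⟩ := dlist_convolution (g := fun y => g (h • y)) (κ := unitBump d)
    (by fun_prop) (fun n => contDiff_unitBump (n := n)) hasCompactSupport_unitBump L
  have hi : Integrable (dlist L (unitBump d)) :=
    (continuous_dlist (contDiff_unitBump (n := (L.length : ℕ))) le_rfl).integrable_of_hasCompactSupport
      hs
  rw [mollify_eq_convolution h hh.ne', dlist_comp_smul, hconv, abs_mul,
    abs_of_nonneg (by positivity), mul_right_comm, mul_comm]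
  refine mul_le_mul_of_nonneg_right ?_ (by positivity)
  rw [convolution_mul_swap, ← integral_mul_const, ← Real.norm_eq_abs]
  refine norm_integral_le_of_norm_le (hi.abs.mul_const A) (ae_of_all _ fun u => ?_)
  rw [norm_mul, mul_comm]
  exact mul_le_mul_of_nonneg_left (hA _) (abs_nonneg _)

lemma pderiv1_mollify {g : EuclideanSpace ℝ (Fin d) → ℝ} (hg : ContDiff ℝ 1 g) (hp : Per1 d g)
    (h : ℝ) (i : Fin d) : pderiv1 d i (mollify h g) = mollify h (pderiv1 d i g) := by
  have hd : Continuous (fderiv ℝ g) := hg.continuous_fderiv (by simp)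
  have hgc := hg.continuous
  have hb : ∃ B, ∀ x, ‖fderiv ℝ g x‖ ≤ B := by
    choose M hM using fun i => (hp.pderiv1 i).exists_bound
      (contDiff_pderiv1 (n := 0) (by simpa using hg) i).continuous
    refine ⟨d * ∑ i, |M i|, fun x => norm_fderiv_le fun i => (hM i x).trans ?_⟩
    exact (le_abs_self _).trans
      (Finset.single_le_sum (f := fun i => |M i|) (fun _ _ => abs_nonneg _) (Finset.mem_univ i))
  obtain ⟨B, hB⟩ := hb
  have hint : ∀ x, Integrable fun u => unitBump d u • fderiv ℝ g (x - h • u) := fun x =>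
    (continuous_unitBump.smul (by fun_prop)).integrable_of_hasCompactSupport
      hasCompactSupport_unitBump.smul_right
  funext x
  have key : HasFDerivAt (mollify h g) (∫ u, unitBump d u • fderiv ℝ g (x - h • u)) x := by
    refine hasFDerivAt_integral_of_dominated_of_fderiv_le (𝕜 := ℝ)
      (F' := fun x u => unitBump d u • fderiv ℝ g (x - h • u))
      (bound := fun u => unitBump d u * B) Filter.univ_mem
      (Filter.Eventually.of_forall fun y => ?_) (integrable_unitBump_mul (by fun_prop))
      (hint x).aestronglyMeasurable (ae_of_all _ fun u y _ => ?_)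
      (integrable_unitBump.mul_const B) (ae_of_all _ fun u y _ => ?_)
    · exact (integrable_unitBump_mul (by fun_prop)).aestronglyMeasurable
    · rw [norm_smul, Real.norm_of_nonneg (unitBump_nonneg u)]
      exact mul_le_mul_of_nonneg_left (hB _) (unitBump_nonneg u)
    · exact ((hasFDerivAt_comp_sub _).2 (hg.differentiable (by simp) (y - h • u)).hasFDerivAt).const_mul _
  rw [pderiv1, key.fderiv, ContinuousLinearMap.integral_apply (hint x)]
  rfl

lemma dlist_mollify {L : List (Fin d)} {g : EuclideanSpace ℝ (Fin d) → ℝ}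
    (hg : ContDiff ℝ L.length g) (hp : Per1 d g) (h : ℝ) :
    dlist L (mollify h g) = mollify h (dlist L g) := by
  induction L with
  | nil => rfl
  | cons i L ih =>
    rw [dlist_cons, ih (hg.of_le (by simp)), pderiv1_mollify
      (contDiff_dlist_of_le (n := 1) hg (by simp [add_comm])) (hp.dlist L)]
    rfl

/-- The mollification error `g - g_h`. -/
noncomputable def resid (h : ℝ) (g : EuclideanSpace ℝ (Fin d) → ℝ) :
    EuclideanSpace ℝ (Fin d) → ℝ :=
  g - mollify h g

lemma contDiff_resid {n : ℕ} {g : EuclideanSpace ℝ (Fin d) → ℝ} (hg : ContDiff ℝ n g) {h : ℝ}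
    (hh : h ≠ 0) : ContDiff ℝ n (resid h g) :=
  hg.sub (contDiff_mollify hg.continuous hh n)

lemma Per1.resid {g : EuclideanSpace ℝ (Fin d) → ℝ} (hg : Per1 d g) (h : ℝ) :
    Per1 d (resid h g) := fun x i => by
  simp [_root_.resid, hg x i, hg.mollify h x i]

lemma abs_resid_le {g : EuclideanSpace ℝ (Fin d) → ℝ} {A : ℝ} (hA : ∀ x, |g x| ≤ A) (h : ℝ)
    (x : EuclideanSpace ℝ (Fin d)) : |resid h g x| ≤ 2 * A := by
  rw [two_mul]
  exact (abs_sub _ _).trans (add_le_add (hA x) (abs_mollify_le hA h x))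

lemma dlist_resid {L : List (Fin d)} {g : EuclideanSpace ℝ (Fin d) → ℝ}
    (hg : ContDiff ℝ L.length g) (hp : Per1 d g) {h : ℝ} (hh : h ≠ 0) :
    dlist L (resid h g) = resid h (dlist L g) := by
  rw [resid, dlist_sub hg (contDiff_mollify hg.continuous hh _), dlist_mollify hg hp, resid]

lemma resid_sub {g₁ g₂ : EuclideanSpace ℝ (Fin d) → ℝ} (h₁ : Continuous g₁) (h₂ : Continuous g₂)
    (h : ℝ) : resid h (g₁ - g₂) = resid h g₁ - resid h g₂ := by
  rw [resid, resid, resid, mollify_sub h₁ h₂]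
  abel

lemma contDiff_resid_iterate {n : ℕ} {g : EuclideanSpace ℝ (Fin d) → ℝ} (hg : ContDiff ℝ n g)
    {h : ℝ} (hh : h ≠ 0) (k : ℕ) : ContDiff ℝ n ((resid h)^[k] g) := by
  induction k with
  | zero => exact hg
  | succ k ih => rw [Function.iterate_succ_apply']; exact contDiff_resid ih hh

lemma continuous_resid_iterate {g : EuclideanSpace ℝ (Fin d) → ℝ} (hg : Continuous g)
    {h : ℝ} (hh : h ≠ 0) (k : ℕ) : Continuous ((resid h)^[k] g) :=
  (contDiff_resid_iterate (n := 0) (contDiff_zero.2 hg) hh k).continuous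

lemma Per1.resid_iterate {g : EuclideanSpace ℝ (Fin d) → ℝ} (hg : Per1 d g) (h : ℝ) (k : ℕ) :
    Per1 d ((_root_.resid h)^[k] g) := by
  induction k with
  | zero => exact hg
  | succ k ih => rw [Function.iterate_succ_apply']; exact ih.resid h

lemma abs_resid_iterate_le {g : EuclideanSpace ℝ (Fin d) → ℝ} {A : ℝ} (hA : ∀ x, |g x| ≤ A)
    (h : ℝ) (k : ℕ) (x : EuclideanSpace ℝ (Fin d)) : |(resid h)^[k] g x| ≤ 2 ^ k * A := by
  induction k generalizing x with
  | zero => simpa using hA x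
  | succ k ih =>
    rw [Function.iterate_succ_apply', pow_succ', mul_assoc]
    exact abs_resid_le ih h x

lemma dlist_resid_iterate {L : List (Fin d)} {g : EuclideanSpace ℝ (Fin d) → ℝ}
    (hg : ContDiff ℝ L.length g) (hp : Per1 d g) {h : ℝ} (hh : h ≠ 0) (k : ℕ) :
    dlist L ((resid h)^[k] g) = (resid h)^[k] (dlist L g) := by
  induction k with
  | zero => rfl
  | succ k ih =>
    rw [Function.iterate_succ_apply', Function.iterate_succ_apply',
      dlist_resid (contDiff_resid_iterate hg hh k) (hp.resid_iterate h k) hh, ih]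

lemma resid_iterate_sub {g₁ g₂ : EuclideanSpace ℝ (Fin d) → ℝ} (h₁ : Continuous g₁)
    (h₂ : Continuous g₂) {h : ℝ} (hh : h ≠ 0) (k : ℕ) :
    (resid h)^[k] (g₁ - g₂) = (resid h)^[k] g₁ - (resid h)^[k] g₂ := by
  induction k with
  | zero => rfl
  | succ k ih =>
    simp only [Function.iterate_succ_apply']
    rw [ih, resid_sub (continuous_resid_iterate h₁ hh k) (continuous_resid_iterate h₂ hh k)]

lemma abs_resid_iterate_le_of_deriv {n : ℕ} {g : EuclideanSpace ℝ (Fin d) → ℝ}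
    (hg : ContDiff ℝ n g) (hp : Per1 d g) {h B : ℝ} (hh : 0 < h)
    (hB : ∀ L : List (Fin d), L.length = n → ∀ x, |dlist L g x| ≤ B)
    (x : EuclideanSpace ℝ (Fin d)) : |(resid h)^[n] g x| ≤ (d * h) ^ n * B := by
  induction n generalizing g B with
  | zero => simpa using hB [] rfl x
  | succ n ih =>
    rw [Function.iterate_succ_apply, pow_succ, mul_assoc]
    refine ih (contDiff_resid (hg.of_le (by simp)) hh.ne') (hp.resid h) fun L hL y => ?_
    subst hL
    rw [dlist_resid (hg.of_le (by simp)) hp hh.ne']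
    exact abs_sub_mollify_le (contDiff_dlist_of_le (n := 1) hg (by simp [add_comm])) hh.le
      (fun i z => hB (i :: L) rfl z) y

lemma contDiff_sub_resid_iterate {g : EuclideanSpace ℝ (Fin d) → ℝ} (hg : Continuous g)
    {h : ℝ} (hh : h ≠ 0) (k n : ℕ) : ContDiff ℝ n (g - (resid h)^[k] g) := by
  induction k with
  | zero => rw [Function.iterate_zero_apply, sub_self]; exact contDiff_zero_fun
  | succ k ih =>
    rw [Function.iterate_succ_apply', resid, ← sub_add]
    exact ih.add (contDiff_mollify (continuous_resid_iterate hg hh k) hh n)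

lemma exists_abs_dlist_sub_resid_iterate_le (L : List (Fin d)) (k : ℕ) :
    ∃ C, 0 ≤ C ∧ ∀ (g : EuclideanSpace ℝ (Fin d) → ℝ) (h A : ℝ), Continuous g → 0 < h →
      (∀ x, |g x| ≤ A) →
        ∀ x, |dlist L (g - (resid h)^[k] g) x| ≤ C * h⁻¹ ^ L.length * A := by
  obtain ⟨C₁, hC₁, H₁⟩ := exists_abs_dlist_mollify_le L
  induction k with
  | zero =>
    refine ⟨C₁, hC₁, fun g h A hg hh hA x => ?_⟩
    have hz : dlist L (0 : EuclideanSpace ℝ (Fin d) → ℝ) = 0 := by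
      have := dlist_sub (L := L) (g₁ := (0 : EuclideanSpace ℝ (Fin d) → ℝ)) (g₂ := 0)
        contDiff_const contDiff_const
      simpa using this
    have hA0 := (abs_nonneg _).trans (hA x)
    rw [Function.iterate_zero_apply, sub_self, hz, Pi.zero_apply, abs_zero]
    positivity
  | succ k ih =>
    obtain ⟨C₂, hC₂, H₂⟩ := ih
    refine ⟨C₂ + C₁ * 2 ^ k, by positivity, fun g h A hg hh hA x => ?_⟩
    have hc := continuous_resid_iterate hg hh.ne' k
    rw [Function.iterate_succ_apply', resid, ← sub_add,
      dlist_add (contDiff_sub_resid_iterate hg hh.ne' k _) (contDiff_mollify hc hh.ne' _)]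
    calc _ ≤ |dlist L (g - (resid h)^[k] g) x| + |dlist L (mollify h ((resid h)^[k] g)) x| :=
          abs_add_le _ _
      _ ≤ C₂ * h⁻¹ ^ L.length * A + C₁ * h⁻¹ ^ L.length * (2 ^ k * A) :=
          add_le_add (H₂ g h A hg hh hA x)
            (H₁ _ h _ hc hh (fun y => abs_resid_iterate_le hA h k y) x)
      _ = _ := by ring

/-- An interpolation inequality of Landau–Kolmogorov type for periodic functions. -/
lemma exists_abs_dlist_le_interpolation (L : List (Fin d)) (n : ℕ) :
    ∃ C, 0 ≤ C ∧ ∀ (g : EuclideanSpace ℝ (Fin d) → ℝ) (h A B : ℝ),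
      ContDiff ℝ (n + L.length : ℕ) g → Per1 d g → 0 < h → (∀ x, |g x| ≤ A) →
        (∀ L' : List (Fin d), L'.length = n + L.length → ∀ x, |dlist L' g x| ≤ B) →
          ∀ x, |dlist L g x| ≤ C * h⁻¹ ^ L.length * A + (d * h) ^ n * B := by
  obtain ⟨C, hC, H⟩ := exists_abs_dlist_sub_resid_iterate_le L n
  refine ⟨C, hC, fun g h A B hg hp hh hA hB x => ?_⟩
  have hg' : ContDiff ℝ L.length g := hg.of_le (by simp)
  have hsplit : dlist L g = dlist L (g - (resid h)^[n] g) + (resid h)^[n] (dlist L g) := by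
    rw [dlist_sub hg' (contDiff_resid_iterate hg' hh.ne' n), dlist_resid_iterate hg' hp hh.ne',
      sub_add_cancel]
  rw [hsplit]
  refine (abs_add_le _ _).trans (add_le_add (H g h A hg.continuous hh hA x) ?_)
  refine abs_resid_iterate_le_of_deriv (contDiff_dlist L hg) (hp.dlist L) hh (fun L' hL' y => ?_) x
  rw [← dlist_append]
  exact hB _ (by simp [hL']) y

end Mollification

section BesovApproximation

open Filter Topology

variable {d : ℕ}

lemma exists_uniform_const {n : ℕ} {P : List (Fin d) → ℝ → Prop}
    (hP : ∀ L C C', C ≤ C' → P L C → P L C')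
    (h : ∀ L : List (Fin d), L.length = n → ∃ C, P L C) :
    ∃ C, 0 ≤ C ∧ ∀ L : List (Fin d), L.length = n → P L C := by
  choose! c hc using h
  obtain ⟨M, hM⟩ := ((List.finite_length_eq (Fin d) n).image c).bddAbove
  exact ⟨max M 0, le_max_right _ _, fun L hL =>
    hP L _ _ ((hM ⟨L, hL, rfl⟩).trans (le_max_left _ _)) (hc L hL)⟩

lemma abs_le_of_supNorm_le {g : EuclideanSpace ℝ (Fin d) → ℝ} (hg : Continuous g) {c : ℝ}
    (h : supNorm d g ≤ ENNReal.ofReal c) (x : EuclideanSpace ℝ (Fin d)) : |g x| ≤ max c 0 := by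
  have hae : ∀ᵐ y, |g y| ≤ max c 0 := by
    have hy := enorm_ae_le_eLpNormEssSup g (volume : Measure (EuclideanSpace ℝ (Fin d)))
    filter_upwards [hy] with y hy
    have h' : ‖g y‖ₑ ≤ ENNReal.ofReal (max c 0) := by
      refine hy.trans ((eLpNorm_exponent_top (f := g)).symm.le.trans (h.trans ?_))
      exact ENNReal.ofReal_le_ofReal (le_max_left _ _)
    rwa [Real.enorm_eq_ofReal_abs, ENNReal.ofReal_le_ofReal_iff (le_max_right _ _)] at h'
  have hopen : IsOpen {y | max c 0 < |g y|} := isOpen_lt continuous_const hg.abs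
  have hnull : volume {y | max c 0 < |g y|} = 0 := by
    rw [ae_iff] at hae
    simpa using hae
  have := hopen.eq_empty_of_measure_zero hnull
  by_contra hx
  have hx' : x ∈ {y | max c 0 < |g y|} := not_le.1 hx
  rw [this] at hx'
  exact hx'

lemma supNorm_le_of_abs_le {g : EuclideanSpace ℝ (Fin d) → ℝ} {c : ℝ} (h : ∀ x, |g x| ≤ c) :
    supNorm d g ≤ ENNReal.ofReal c := by
  rw [supNorm, eLpNorm_exponent_top]
  exact eLpNormEssSup_le_of_ae_bound (ae_of_all _ h)

/-- Approximability of `f` by smooth periodic functions at the geometric rate `q ^ j`, in terms of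
pointwise bounds and of partial derivatives along lists of indices. -/
def ApproxRate (q : ℝ) (N : ℕ) (f : EuclideanSpace ℝ (Fin d) → ℝ) (C : ℝ) : Prop :=
  ∃ fs : ℕ → EuclideanSpace ℝ (Fin d) → ℝ, ∀ j, 1 ≤ j →
    Per1 d (fs j) ∧ ContDiff ℝ N (fs j) ∧ (∀ x, |f x - fs j x| ≤ C * q ^ j) ∧
      ∀ L : List (Fin d), L.length = N → ∀ x, |dlist L (fs j) x| ≤ C * q ^ j * 2 ^ (j * N)

lemma ApproxRate.mono {q : ℝ} (hq : 0 ≤ q) {N : ℕ} {f : EuclideanSpace ℝ (Fin d) → ℝ} {C C' : ℝ}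
    (hC : C ≤ C') (h : ApproxRate q N f C) : ApproxRate q N f C' := by
  obtain ⟨fs, h⟩ := h
  refine ⟨fs, fun j hj => ?_⟩
  obtain ⟨h₁, h₂, h₃, h₄⟩ := h j hj
  exact ⟨h₁, h₂, fun x => (h₃ x).trans (by gcongr), fun L hL x => (h₄ L hL x).trans (by gcongr)⟩

lemma memBesov_iff_approxRate {β : ℝ} {N : ℕ} {f : EuclideanSpace ℝ (Fin d) → ℝ}
    (hf : Continuous f) : MemBesov d β N f ↔ ∃ C, ApproxRate ((2 : ℝ) ^ (-β)) N f C := by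
  have e₁ : ∀ j : ℕ, (2 : ℝ) ^ (-(j : ℝ) * β) = ((2 : ℝ) ^ (-β)) ^ j := fun j => by
    rw [← Real.rpow_natCast, ← Real.rpow_mul (by norm_num)]
    congr 1
    ring
  have e₂ : ∀ j : ℕ, (2 : ℝ) ^ (((N : ℝ) - β) * j) = ((2 : ℝ) ^ (-β)) ^ j * 2 ^ (j * N) := fun j => by
    rw [← e₁, ← Real.rpow_natCast, ← Real.rpow_add (by norm_num)]
    congr 1
    push_cast
    ring
  constructor
  · rintro ⟨fs, hfs, ⟨C₁, h₁⟩, C₂, h₂⟩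
    refine ⟨max (max C₁ C₂) 0, fs, fun j hj => ⟨(hfs j hj).2.1, (hfs j hj).2.2, fun x => ?_,
      fun L hL x => ?_⟩⟩
    · refine (abs_le_of_supNorm_le (hf.sub (hfs j hj).2.2.continuous) (h₁ j hj) x).trans
        (max_le ?_ (by positivity))
      rw [e₁]
      gcongr
      exact (le_max_left _ _).trans (le_max_left _ _)
    · have hc := (hfs j hj).2.2
      have h := h₂ (fun i => L.count i) ((sum_count_eq_length L).trans hL) j hj
      rw [← dlist_eq_pderivM L (by rwa [hL])] at h
      refine (abs_le_of_supNorm_le (continuous_dlist hc hL.le) h x).trans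
        (max_le ?_ (by positivity))
      rw [e₂, ← mul_assoc]
      gcongr
      exact (le_max_right _ _).trans (le_max_left _ _)
  · rintro ⟨C, fs, h⟩
    refine ⟨fs, fun j hj => ?_, ⟨C, fun j hj => ?_⟩, C, fun σ hσ j hj => ?_⟩
    · exact ⟨(h j hj).1.exists_bound (h j hj).2.1.continuous, (h j hj).1, (h j hj).2.1⟩
    · rw [e₁]
      exact supNorm_le_of_abs_le (h j hj).2.2.1
    · rw [e₂, ← mul_assoc, pderivM_eq_dlist]
      exact supNorm_le_of_abs_le ((h j hj).2.2.2 _ ((length_multiList σ).trans hσ))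

lemma contDiff_of_tendstoUniformly {n : ℕ} {F : ℕ → EuclideanSpace ℝ (Fin d) → ℝ}
    {G : List (Fin d) → EuclideanSpace ℝ (Fin d) → ℝ} (hF : ∀ j, ContDiff ℝ n (F j))
    (hG : ∀ L : List (Fin d), L.length ≤ n →
      TendstoUniformly (fun j => dlist L (F j)) (G L) atTop) :
    ContDiff ℝ n (G []) ∧ ∀ L : List (Fin d), L.length ≤ n → dlist L (G []) = G L := by
  induction n generalizing F G with
  | zero =>
    refine ⟨contDiff_zero.2 ((hG [] le_rfl).continuous
      (Frequently.of_forall fun j => (hF j).continuous)), fun L hL => ?_⟩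
    rw [List.length_eq_zero_iff.1 (Nat.le_zero.1 hL)]
    rfl
  | succ n ih =>
    have hstep : ∀ i : Fin d, ContDiff ℝ n (G [i]) ∧
        ∀ L : List (Fin d), L.length ≤ n → dlist L (G [i]) = G (L ++ [i]) := fun i =>
      ih (F := fun j => pderiv1 d i (F j)) (G := fun L => G (L ++ [i]))
        (fun j => contDiff_pderiv1 (hF j) i) fun L hL => by
          simpa [dlist_append] using hG (L ++ [i]) (by simpa using hL)
    have hderiv : ∀ x, HasFDerivAt (G []) (∑ i, G [i] x •
        (EuclideanSpace.proj i : EuclideanSpace ℝ (Fin d) →L[ℝ] ℝ)) x := by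
      refine hasFDerivAt_of_tendstoUniformly (l := atTop) (𝕜 := ℝ) (f := F)
        (f' := fun j => fderiv ℝ (F j)) ?_
        (fun j x => ((hF j).differentiable (by simp) x).hasFDerivAt)
        (fun x => (hG [] (by simp)).tendsto_at x)
      rw [Metric.tendstoUniformly_iff]
      intro ε hε
      have hev : ∀ᶠ j in atTop, ∀ i x, dist (G [i] x) (pderiv1 d i (F j) x) < ε / (d + 1) :=
        eventually_all.2 fun i =>
          Metric.tendstoUniformly_iff.1 (hG [i] (by simp)) _ (by positivity)
      filter_upwards [hev] with j hj x
      rw [dist_eq_norm, fderiv_eq_sum_pderiv1, ← Finset.sum_sub_distrib]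
      simp only [← sub_smul]
      refine (norm_sum_smul_proj_le fun i => (hj i x).le).trans_lt ?_
      rw [← mul_div_assoc, div_lt_iff₀ (by positivity)]
      linarith
    have hpd : ∀ i, pderiv1 d i (G []) = G [i] := fun i => by
      funext x
      rw [pderiv1, (hderiv x).fderiv]
      simp
    refine ⟨contDiff_succ_iff_hasFDerivAt.2 ⟨_, ContDiff.sum fun i _ =>
      (hstep i).1.smul contDiff_const, hderiv⟩, fun L hL => ?_⟩
    rcases List.eq_nil_or_concat' L with rfl | ⟨L, i, rfl⟩
    · rfl
    · rw [dlist_append, dlist_cons, dlist_nil, hpd, (hstep i).2 L (by simpa using hL)]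

lemma exists_abs_dlist_increment_le {q : ℝ} (hq : 0 < q) (hq1 : q ≤ 1) {C : ℝ}
    {F : ℕ → EuclideanSpace ℝ (Fin d) → ℝ} {f : EuclideanSpace ℝ (Fin d) → ℝ}
    (L : List (Fin d)) (n : ℕ) (hp : ∀ j, Per1 d (F j))
    (hF : ∀ j, ContDiff ℝ (n + L.length : ℕ) (F j)) (hA : ∀ j x, |f x - F j x| ≤ C * q ^ j)
    (hB : ∀ j, ∀ L' : List (Fin d), L'.length = n + L.length →
      ∀ x, |dlist L' (F j) x| ≤ C * q ^ j * 2 ^ (j * (n + L.length))) :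
    ∃ D, ∀ j x, |dlist L (F j) x - dlist L (F (j + 1)) x| ≤ D * (q * 2 ^ L.length) ^ j := by
  obtain ⟨K, hK, H⟩ := exists_abs_dlist_le_interpolation L n
  have hC : 0 ≤ C := by simpa using (abs_nonneg _).trans (hA 0 0)
  have hqs : ∀ j : ℕ, q ^ (j + 1) ≤ q ^ j := fun j => pow_le_pow_of_le_one hq.le hq1 (by simp)
  refine ⟨K * (2 * C) + d ^ n * (C * (1 + 2 ^ (n + L.length))), fun j x => ?_⟩
  have hsub : ∀ L' : List (Fin d), L'.length ≤ n + L.length →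
      dlist L' (F j - F (j + 1)) = dlist L' (F j) - dlist L' (F (j + 1)) := fun L' hL' =>
    dlist_sub ((hF j).of_le (by exact_mod_cast hL')) ((hF (j + 1)).of_le (by exact_mod_cast hL'))
  have key := H (F j - F (j + 1)) (2 ^ j)⁻¹ (2 * C * q ^ j)
    (C * (1 + 2 ^ (n + L.length)) * q ^ j * 2 ^ (j * (n + L.length)))
    ((hF j).sub (hF (j + 1))) (fun y i => by simp [hp j y i, hp (j + 1) y i]) (by positivity) ?_ ?_ x
  · rw [hsub L (by simp), Pi.sub_apply] at key
    refine key.trans (le_of_eq ?_)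
    rw [inv_inv, mul_pow, mul_pow, inv_pow, ← pow_mul, ← pow_mul, ← pow_mul, mul_add j, pow_add,
      mul_comm L.length j]
    field_simp
    ring
  · intro y
    have h₁ := hA j y
    have h₂ := (hA (j + 1) y).trans (mul_le_mul_of_nonneg_left (hqs j) hC)
    rw [Pi.sub_apply]
    rw [abs_le] at *
    constructor <;> linarith
  · intro L' hL' y
    rw [hsub L' hL'.le, Pi.sub_apply]
    refine (abs_sub _ _).trans ?_
    have h₁ := hB j L' hL' y
    have h₂ := (hB (j + 1) L' hL' y).trans (mul_le_mul_of_nonneg_right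
      (mul_le_mul_of_nonneg_left (hqs j) hC) (by positivity))
    rw [add_mul j, pow_add, one_mul] at h₂
    calc _ ≤ _ := add_le_add h₁ h₂
      _ = _ := by ring

theorem approxRate_dlist_of_approxRate {q : ℝ} {m n : ℕ} (hq : 0 < q) (hqm : q * 2 ^ m < 1)
    {f : EuclideanSpace ℝ (Fin d) → ℝ} {C : ℝ} (h : ApproxRate q (m + n) f C) :
    ContDiff ℝ m f ∧
      ∀ L : List (Fin d), L.length = m → ∃ C', ApproxRate (q * 2 ^ m) n (dlist L f) C' := by
  obtain ⟨fs, h⟩ := h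
  have hrle : ∀ k ≤ m, q * 2 ^ k < 1 := fun k hk => lt_of_le_of_lt (by gcongr; norm_num) hqm
  have hq1 : q < 1 := by simpa using hrle 0 (by simp)
  have hC : 0 ≤ C := by
    have := (abs_nonneg _).trans ((h 1 le_rfl).2.2.1 0)
    exact nonneg_of_mul_nonneg_left this (by positivity)
  have hFd : ∀ j, ContDiff ℝ (m + n : ℕ) (fs (j + 1)) := fun j => (h (j + 1) (by simp)).2.1
  have hFa : ∀ j x, |f x - fs (j + 1) x| ≤ C * q ^ (j + 1) := fun j => (h (j + 1) (by simp)).2.2.1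
  have hqs : ∀ j : ℕ, q ^ (j + 1) ≤ q ^ j := fun j => pow_le_pow_of_le_one hq.le hq1.le (by simp)
  have hincr : ∀ L : List (Fin d), ∃ D, L.length ≤ m → ∀ j x,
      dist (dlist L (fs (j + 1)) x) (dlist L (fs (j + 1 + 1)) x) ≤ D * (q * 2 ^ L.length) ^ j := by
    intro L
    by_cases hL : L.length ≤ m
    · obtain ⟨l, hl⟩ : ∃ l, l + L.length = m + n := ⟨m + n - L.length, by lia⟩
      obtain ⟨D, hD⟩ := exists_abs_dlist_increment_le (F := fun j => fs (j + 1)) (f := f)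
        (C := C * 2 ^ (m + n)) hq hq1.le L l
        (fun j => (h (j + 1) (by simp)).1) (fun j => by rw [hl]; exact hFd j)
        (fun j x => (hFa j x).trans
          (mul_le_mul (le_mul_of_one_le_right hC (one_le_pow₀ (by norm_num))) (hqs j)
            (by positivity) (by positivity)))
        (fun j L' hL' x => by
          refine ((h (j + 1) (by simp)).2.2.2 L' (by rw [hL', hl]) x).trans ?_
          rw [hl, add_mul, one_mul, pow_add (2 : ℝ)]
          calc C * q ^ (j + 1) * (2 ^ (j * (m + n)) * 2 ^ (m + n))
              ≤ C * q ^ j * (2 ^ (j * (m + n)) * 2 ^ (m + n)) :=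
                mul_le_mul_of_nonneg_right (mul_le_mul_of_nonneg_left (hqs j) hC) (by positivity)
            _ = _ := by ring)
      exact ⟨D, fun _ => hD⟩
    · exact ⟨0, fun hL' => absurd hL' hL⟩
  choose D hD using hincr
  have hlim : ∀ L : List (Fin d), L.length ≤ m → ∀ x, ∃ y,
      Tendsto (fun j => dlist L (fs (j + 1)) x) atTop (𝓝 y) := fun L hL x =>
    cauchySeq_tendsto_of_complete
      (cauchySeq_of_le_geometric _ _ (hrle _ hL) fun j => hD L hL j x)
  choose! G hG using hlim
  have hdist : ∀ L : List (Fin d), L.length ≤ m → ∀ j x, dist (dlist L (fs (j + 1)) x) (G L x) ≤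
      D L * (q * 2 ^ L.length) ^ j / (1 - q * 2 ^ L.length) := fun L hL j x =>
    dist_le_of_le_geometric_of_tendsto _ _ (hrle _ hL) (fun j => hD L hL j x) (hG L hL x) j
  have hunif : ∀ L : List (Fin d), L.length ≤ m →
      TendstoUniformly (fun j => dlist L (fs (j + 1))) (G L) atTop := by
    intro L hL
    have ht : Tendsto (fun j : ℕ => D L * (q * 2 ^ L.length) ^ j / (1 - q * 2 ^ L.length)) atTop
        (𝓝 0) := by
      simpa using ((tendsto_pow_atTop_nhds_zero_of_lt_one (by positivity)
        (hrle _ hL)).const_mul (D L)).div_const (1 - q * 2 ^ L.length)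
    rw [Metric.tendstoUniformly_iff]
    intro ε hε
    filter_upwards [ht.eventually_lt_const hε] with j hj x
    rw [dist_comm]
    exact (hdist L hL j x).trans_lt hj
  have hGf : G [] = f := by
    funext x
    refine tendsto_nhds_unique (hG [] (by simp) x) ?_
    rw [tendsto_iff_dist_tendsto_zero]
    have ht : Tendsto (fun j : ℕ => C * q ^ (j + 1)) atTop (𝓝 0) := by
      simpa using ((tendsto_pow_atTop_nhds_zero_of_lt_one hq.le hq1).comp
        (tendsto_add_atTop_nat 1)).const_mul C
    refine squeeze_zero (fun _ => dist_nonneg) (fun j => ?_) ht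
    rw [dist_comm]
    exact hFa j x
  obtain ⟨hcd, hdl⟩ := contDiff_of_tendstoUniformly (n := m) (F := fun j => fs (j + 1)) (G := G)
    (fun j => (hFd j).of_le (by simp)) hunif
  rw [hGf] at hcd hdl
  refine ⟨hcd, fun L hL => ?_⟩
  have hr : 0 < q * 2 ^ m := by positivity
  have hr' : 0 < 1 - q * 2 ^ m := sub_pos.2 hqm
  set E : ℝ := D L / (q * 2 ^ m * (1 - q * 2 ^ m)) with hE
  have hbound : ∀ j x, |dlist L f x - dlist L (fs (j + 1)) x| ≤ E * (q * 2 ^ m) ^ (j + 1) := by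
    intro j x
    have := hdist L hL.le j x
    rw [hL, dist_comm, Real.dist_eq, ← hdl L hL.le] at this
    refine this.trans (le_of_eq ?_)
    rw [hE, pow_succ]
    field_simp
  have hE0 : 0 ≤ E :=
    nonneg_of_mul_nonneg_left ((abs_nonneg _).trans (hbound 0 0)) (by positivity)
  refine ⟨C + E, fun j => dlist L (fs j), fun j hj => ⟨(h j hj).1.dlist L,
    contDiff_dlist_of_le (h j hj).2.1 (by lia), fun x => ?_, fun L' hL' x => ?_⟩⟩
  · obtain ⟨j, rfl⟩ := Nat.exists_eq_add_of_le' hj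
    refine (hbound j x).trans ?_
    gcongr
    linarith
  · rw [← dlist_append]
    refine ((h j hj).2.2.2 _ (by simp [hL, hL', add_comm]) x).trans ?_
    rw [mul_pow, ← pow_mul, mul_add, pow_add, mul_comm m j]
    calc C * q ^ j * (2 ^ (j * m) * 2 ^ (j * n)) = C * (q ^ j * 2 ^ (j * m)) * 2 ^ (j * n) := by ring
      _ ≤ _ := by gcongr; linarith

theorem approxRate_of_approxRate_dlist {q : ℝ} {m n : ℕ} (hq : 0 < q)
    {f : EuclideanSpace ℝ (Fin d) → ℝ} (hf : ContDiff ℝ m f) (hp : Per1 d f)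
    (h : ∀ L : List (Fin d), L.length = m → ∃ C, ApproxRate (q * 2 ^ m) n (dlist L f) C) :
    ∃ C, ApproxRate q (m + n) f C := by
  obtain ⟨C, hC, H⟩ := exists_uniform_const (P := fun L C => ApproxRate (q * 2 ^ m) n (dlist L f) C)
    (fun L C C' hCC' hL => hL.mono (by positivity) hCC') h
  choose! p hpp using H
  obtain ⟨K, hK, HK⟩ := exists_uniform_const (n := n)
    (P := fun L C => 0 ≤ C ∧ ∀ (g : EuclideanSpace ℝ (Fin d) → ℝ) (h A : ℝ), Continuous g → 0 < h →
      (∀ x, |g x| ≤ A) →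
        ∀ x, |dlist L (g - (resid h)^[m + n] g) x| ≤ C * h⁻¹ ^ L.length * A)
    (fun L C C' hCC' ⟨hC, hL⟩ => ⟨hC.trans hCC', fun g h A hg hh hA x => by
      have hA0 := (abs_nonneg _).trans (hA x)
      exact (hL g h A hg hh hA x).trans (by gcongr)⟩)
    fun L _ => exists_abs_dlist_sub_resid_iterate_le L (m + n)
  refine ⟨d ^ m * ((2 ^ n + d ^ n) * C) + (K * C + (1 + 2 ^ (m + n)) * C),
    fun j => f - (resid (2 ^ j)⁻¹)^[m + n] f, fun j hj => ?_⟩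
  have hh : (0 : ℝ) < (2 ^ j)⁻¹ := by positivity
  beta_reduce
  set η : ℝ := (2 ^ j)⁻¹ with hη
  set a : ℝ := C * (q * 2 ^ m) ^ j with ha
  have ha0 : 0 ≤ a := by positivity
  have haq : a = C * q ^ j * 2 ^ (j * m) := by
    rw [ha, mul_pow, ← pow_mul, mul_comm m j, mul_assoc]
  have hgc : ∀ L : List (Fin d), L.length = m → Continuous (dlist L f) := fun L hL =>
    continuous_dlist hf hL.le
  refine ⟨fun x i => ?_, contDiff_sub_resid_iterate hf.continuous hh.ne' _ _, fun x => ?_,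
    fun L hL x => ?_⟩
  · simp [hp x i, hp.resid_iterate η (m + n) x i]
  · rw [Pi.sub_apply, _root_.sub_sub_cancel, Function.iterate_add_apply]
    have hb := abs_resid_iterate_le_of_deriv (n := m) (contDiff_resid_iterate hf hh.ne' n)
      (hp.resid_iterate η n) hh (B := (2 ^ n + d ^ n) * a) (fun L hL y => ?_) x
    · refine hb.trans ?_
      calc (d * η) ^ m * ((2 ^ n + d ^ n) * a)
          = d ^ m * ((2 ^ n + d ^ n) * C) * q ^ j := by
            rw [haq, hη, mul_pow, inv_pow, ← pow_mul]
            field_simp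
        _ ≤ _ := by
            gcongr
            exact le_add_of_nonneg_right (by positivity)
    · obtain ⟨hper, hcd, happ, hder⟩ := hpp L hL j hj
      rw [dlist_resid_iterate (hf.of_le (by simp [hL])) hp hh.ne']
      have hs := congrFun (resid_iterate_sub (hgc L hL) hcd.continuous hh.ne' n) y
      rw [Pi.sub_apply, eq_sub_iff_add_eq] at hs
      rw [← hs]
      refine (abs_add_le _ _).trans ?_
      rw [add_mul]
      refine add_le_add (abs_resid_iterate_le happ η n y) ?_
      refine (abs_resid_iterate_le_of_deriv hcd hper hh hder y).trans (le_of_eq ?_)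
      rw [← ha, hη, mul_pow, inv_pow, ← pow_mul]
      field_simp
  · obtain ⟨L₁, L₂, rfl, hL₁, hL₂⟩ : ∃ L₁ L₂, L = L₁ ++ L₂ ∧ L₁.length = n ∧ L₂.length = m :=
      ⟨L.take n, L.drop n, (List.take_append_drop n L).symm, by simp [hL], by simp [hL]⟩
    obtain ⟨hper, hcd, happ, hder⟩ := hpp L₂ hL₂ j hj
    have hf₂ : ContDiff ℝ L₂.length f := hf.of_le (by simp [hL₂])
    have hcd₁ : ContDiff ℝ L₁.length (p L₂ j) := by rwa [hL₁]
    have hg := hgc L₂ hL₂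
    have hsplit : dlist L₂ (f - (resid η)^[m + n] f) =
        (dlist L₂ f - p L₂ j - (resid η)^[m + n] (dlist L₂ f - p L₂ j)) +
          (p L₂ j - (resid η)^[m + n] (p L₂ j)) := by
      rw [dlist_sub hf₂ (contDiff_resid_iterate hf₂ hh.ne' _), dlist_resid_iterate hf₂ hp hh.ne',
        resid_iterate_sub hg hcd.continuous hh.ne']
      abel
    have hR := contDiff_resid_iterate hcd₁ hh.ne' (m + n)
    rw [dlist_append, hsplit, dlist_add
      (g₁ := dlist L₂ f - p L₂ j - (resid η)^[m + n] (dlist L₂ f - p L₂ j))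
      (g₂ := p L₂ j - (resid η)^[m + n] (p L₂ j))
      (contDiff_sub_resid_iterate (hg.sub hcd.continuous) hh.ne' _ _) (hcd₁.sub hR),
      dlist_sub hcd₁ hR, dlist_resid_iterate hcd₁ hper hh.ne']
    have h₁ := (HK L₁ hL₁).2 (dlist L₂ f - p L₂ j) η a (hg.sub hcd.continuous) hh happ x
    have h₂ := hder L₁ hL₁ x
    have h₃ := abs_resid_iterate_le (hder L₁ hL₁) η (m + n) x
    rw [hL₁, hη, inv_inv, ← pow_mul] at h₁
    calc _ ≤ _ := (abs_add_le _ _).trans (add_le_add h₁ ((abs_sub _ _).trans (add_le_add h₂ h₃)))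
      _ = (K * C + (1 + 2 ^ (m + n)) * C) * q ^ j * 2 ^ (j * (m + n)) := by
          rw [← ha, haq, mul_add j, pow_add (2 : ℝ) (j * m)]
          ring
      _ ≤ _ := mul_le_mul_of_nonneg_right (mul_le_mul_of_nonneg_right
          (le_add_of_nonneg_left (by positivity)) (by positivity)) (by positivity)

end BesovApproximation

/-- Proposition 2, case `β > 1`: with `m` the largest integer strictly less than `β`,
`α = β - m ∈ (0,1]`, `N = ⌈β⌉` and `N'` the smallest integer strictly greater than `α`,
a continuous bounded 1-periodic `f` belongs to `B^β_{∞,∞}` (approximation sense) iff `f` is of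
class `C^m` and every partial derivative of `f` of order `m` belongs to `B^α_{∞,∞}`
(approximation sense). -/
theorem besov_iff_deriv_besov (d : ℕ) (hd : 1 ≤ d) (β : ℝ) (hβ : 1 < β)
    (m : ℕ) (hm : (m : ℝ) < β ∧ β ≤ (m : ℝ) + 1)
    (N : ℕ) (hN : β < (N : ℝ) ∧ (N : ℝ) ≤ β + 1)
    (N' : ℕ) (hN' : β - (m : ℝ) < (N' : ℝ) ∧ (N' : ℝ) ≤ β - (m : ℝ) + 1)
    (f : EuclideanSpace ℝ (Fin d) → ℝ) (hfc : Continuous f)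
    (hfb : ∃ M, ∀ x, |f x| ≤ M) (hper : Per1 d f) :
    MemBesov d β N f ↔
      (ContDiff ℝ m f ∧ ∀ σ : Fin d → ℕ, (∑ i, σ i) = m →
        MemBesov d (β - (m : ℝ)) N' (pderivM d σ f)) := by
  have hNm : N = m + N' := by
    have h₁ : (N : ℝ) < (m + N' + 1 : ℕ) := by push_cast; linarith [hN.2, hN'.1]
    have h₂ : ((m + N' : ℕ) : ℝ) < (N + 1 : ℕ) := by push_cast; linarith [hN.1, hN'.2]
    have h₁' : N < m + N' + 1 := by exact_mod_cast h₁
    have h₂' : m + N' < N + 1 := by exact_mod_cast h₂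
    lia
  subst hNm
  have hq : (0 : ℝ) < 2 ^ (-β) := by positivity
  have hqm : (2 : ℝ) ^ (-(β - m)) = 2 ^ (-β) * 2 ^ m := by
    rw [← Real.rpow_natCast, ← Real.rpow_add (by norm_num)]
    congr 1
    ring
  have hqm1 : (2 : ℝ) ^ (-β) * 2 ^ m < 1 := by
    rw [← hqm]
    exact Real.rpow_lt_one_of_one_lt_of_neg (by norm_num) (by linarith [hm.1])
  rw [memBesov_iff_approxRate hfc]
  constructor
  · rintro ⟨C, hC⟩
    obtain ⟨hf, hL⟩ := approxRate_dlist_of_approxRate hq hqm1 hC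
    refine ⟨hf, fun σ hσ => ?_⟩
    have hlen := (length_multiList σ).trans hσ
    rw [pderivM_eq_dlist, memBesov_iff_approxRate (continuous_dlist hf hlen.le), hqm]
    exact hL _ hlen
  · rintro ⟨hf, hσ⟩
    refine approxRate_of_approxRate_dlist hq hf hper fun L hL => ?_
    have h := hσ (fun i => L.count i) ((sum_count_eq_length L).trans hL)
    rwa [← dlist_eq_pderivM L (by rwa [hL]), memBesov_iff_approxRate (continuous_dlist hf hL.le),
      hqm] at h
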